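/- (Corollary) For all integers M ≥ 0 and a: Σ_{k=0}^∞ C̄_{M,k}(q) [2k choose k-a] = q^{a²} [2M choose M-2a], where C̄_{M,k}(q) = Σ_{i=0}^M q^{M(M-i)+k²} [M choose i][i choose 2k]. -/

import Mathlib

open Finset

noncomputable section

/-- The field of rational functions over ℚ in which the identities are stated. -/
abbrev K : Type := RatFunc ℚ

/-- The variable. -/
def tq : K := RatFunc.X

/-- Gaussian binomial coefficient `[n choose k]` in the variable `p`:
`∏_{j=1}^{k} (1 - p^(n-k+j))/(1 - p^j)` when `0 ≤ k ≤ n`, and `0` otherwise. -/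
def gb (p : K) (n k : ℤ) : K :=
  if 0 ≤ k ∧ k ≤ n then
    ∏ j ∈ Finset.range k.toNat, (1 - p ^ (n - k + 1 + (j : ℤ))) / (1 - p ^ (1 + (j : ℤ)))
  else 0

/-- `C̄_{M,k}(q) = Σ_{i=0}^M q^{M(M-i)+k²} [M choose i][i choose 2k]`. -/
def Cbar (M k : ℕ) : K :=
  ∑ i ∈ Finset.range (M + 1),
    tq ^ ((M : ℤ) * ((M : ℤ) - i) + (k : ℤ) ^ 2) * gb tq M i * gb tq i (2 * k)

section QBinom

variable {R : Type*} [CommRing R]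

/-- The Gaussian binomial coefficient with natural indices, defined by the `q`-Pascal rule. -/
def qBinom (q : R) : ℕ → ℕ → R
  | _, 0 => 1
  | 0, _ + 1 => 0
  | n + 1, k + 1 => qBinom q n k + q ^ (k + 1) * qBinom q n (k + 1)

/-- The `q`-Pochhammer symbol `(q; q)_n = ∏_{j=1}^{n} (1 - q^j)`. -/
def qPoch (q : R) (n : ℕ) : R := ∏ j ∈ range n, (1 - q ^ (1 + j))

theorem qPoch_succ (q : R) (n : ℕ) : qPoch q (n + 1) = qPoch q n * (1 - q ^ (1 + n)) :=
  prod_range_succ _ _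

theorem qBinom_zero_right (q : R) (n : ℕ) : qBinom q n 0 = 1 := by
  cases n <;> rfl

theorem qBinom_succ_succ (q : R) (n k : ℕ) :
    qBinom q (n + 1) (k + 1) = qBinom q n k + q ^ (k + 1) * qBinom q n (k + 1) := rfl

theorem qBinom_eq_zero (q : R) {n k : ℕ} (h : n < k) : qBinom q n k = 0 := by
  induction n generalizing k with
  | zero => obtain ⟨k, rfl⟩ := Nat.exists_eq_succ_of_ne_zero h.ne'; rfl
  | succ n ih =>
    obtain ⟨k, rfl⟩ := Nat.exists_eq_succ_of_ne_zero (Nat.ne_zero_of_lt h)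
    rw [Nat.succ_eq_add_one, qBinom_succ_succ, ih (by omega), ih (by omega), mul_zero, add_zero]

theorem qBinom_self (q : R) (n : ℕ) : qBinom q n n = 1 := by
  induction n with
  | zero => rfl
  | succ n ih => rw [qBinom_succ_succ, ih, qBinom_eq_zero q n.lt_succ_self, mul_zero, add_zero]

theorem qBinom_mul_qPoch (q : R) (k l : ℕ) :
    qBinom q (k + l) k * (qPoch q k * qPoch q l) = qPoch q (k + l) := by
  induction k generalizing l with
  | zero => simp [qBinom_zero_right, qPoch]
  | succ k ihk =>
    induction l with
    | zero => simp [qBinom_self, qPoch]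
    | succ l ihl =>
      have h₁ := ihk (l + 1)
      rw [← add_assoc] at h₁
      rw [show k + 1 + l = k + l + 1 by ring] at ihl
      rw [show k + 1 + (l + 1) = k + l + 1 + 1 by ring, qBinom_succ_succ, qPoch_succ q (k + l + 1)]
      rw [qPoch_succ q k] at ihl ⊢
      rw [qPoch_succ q l] at h₁ ⊢
      linear_combination (1 - q ^ (1 + k)) * h₁ + q ^ (k + 1) * (1 - q ^ (1 + l)) * ihl

/-- The `q`-Vandermonde identity. -/
theorem qBinom_add (q : R) (m n k : ℕ) :
    qBinom q (m + n) k =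
      ∑ j ∈ range (k + 1), qBinom q m j * qBinom q n (k - j) * q ^ ((m - j) * (k - j)) := by
  induction m generalizing k with
  | zero =>
    rw [sum_range_succ', sum_eq_zero fun j _ => by rw [qBinom_eq_zero q j.succ_pos]; ring]
    simp [qBinom_zero_right]
  | succ m ih =>
    have key (k j : ℕ) (hj : j ≤ k) :
        q ^ j * qBinom q m j * qBinom q n (k - j) * q ^ ((m + 1 - j) * (k - j)) =
          q ^ k * (qBinom q m j * qBinom q n (k - j) * q ^ ((m - j) * (k - j))) := by
      rcases le_or_gt j m with h | h
      · obtain ⟨d, rfl⟩ := Nat.exists_eq_add_of_le h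
        obtain ⟨e, rfl⟩ := Nat.exists_eq_add_of_le hj
        rw [show j + d + 1 - j = d + 1 by omega, Nat.add_sub_cancel_left, Nat.add_sub_cancel_left]
        ring
      · rw [qBinom_eq_zero q h]; ring
    cases k with
    | zero => simp [qBinom_zero_right]
    | succ k =>
      rw [show m + 1 + n = m + n + 1 by ring, qBinom_succ_succ, ih k, ih (k + 1), mul_sum,
        ← sum_congr rfl fun j hj => key (k + 1) j (by simp at hj; omega),
        sum_range_succ' _ (k + 1), sum_range_succ' _ (k + 1), ← add_assoc, ← sum_add_distrib]
      congr 1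
      · refine sum_congr rfl fun j _ => ?_
        rw [qBinom_succ_succ, Nat.add_sub_add_right, Nat.add_sub_add_right]
        ring
      · simp [qBinom_zero_right]

theorem qBinom_add_right_eq_sum (q : R) {M j : ℕ} (hj : j ≤ M) (b : ℕ) :
    qBinom q M (j + b) =
      ∑ m ∈ range (j + 1), qBinom q j m * qBinom q (M - j) (j - m + b) *
        q ^ ((M - j - (j - m + b)) * m) := by
  conv_lhs => rw [← Nat.sub_add_cancel hj, qBinom_add, ← sum_range_reflect]
  rw [← sum_subset (s₁ := range (j + 1)) (by intro x; simp; omega) fun m _ hm => by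
    rw [qBinom_eq_zero q (n := j) (by simp at *; omega)]; ring]
  refine sum_congr rfl fun m hm => ?_
  have hm : m ≤ j := by simp at hm; omega
  rw [show j + b + 1 - 1 - m = j - m + b by omega, show j + b - (j - m + b) = m by omega]
  ring

variable [IsDomain R] {q : R}

theorem qBinom_symm_add (hq : ∀ n, qPoch q n ≠ 0) (k l : ℕ) :
    qBinom q (k + l) k = qBinom q (k + l) l := by
  have h := qBinom_mul_qPoch q l k
  rw [add_comm l k, mul_comm (qPoch q l), ← qBinom_mul_qPoch q k l] at h
  exact (mul_right_cancel₀ (mul_ne_zero (hq k) (hq l)) h).symm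

theorem qBinom_two_mul (hq : ∀ n, qPoch q n ≠ 0) (d b : ℕ) :
    qBinom q (2 * (d + b)) d =
      ∑ j ∈ range (d + b + 1),
        q ^ (j * (j + b)) * (qBinom q (d + b) j * qBinom q (d + b) (j + b)) := by
  rw [two_mul, qBinom_add, ← sum_range_reflect]
  rw [← sum_subset (s₁ := range (d + 1)) (s₂ := range (d + b + 1)) (by intro x; simp; omega) fun j _ hj => by
    rw [qBinom_eq_zero q (k := j + b) (by simp at hj; omega)]; ring]
  refine sum_congr rfl fun j hj => ?_
  obtain ⟨e, rfl⟩ := Nat.exists_eq_add_of_le (show j ≤ d by simp at hj; omega)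
  rw [show j + e + 1 - 1 - j = e by omega, show j + e - e = j by omega,
    show j + e + b - e = j + b by omega, show j + e + b = e + (j + b) by ring,
    qBinom_symm_add hq e (j + b)]
  ring

theorem qBinom_multinomial (hq : ∀ n, qPoch q n ≠ 0) (m c e f : ℕ) :
    qBinom q (m + c + e + f) (m + c) * qBinom q (m + c) m * qBinom q (e + f) e =
      qBinom q (m + c + e + f) (c + e + f) * qBinom q (c + e + f) (c + e) *
        qBinom q (c + e) c := by
  have h₁ := qBinom_mul_qPoch q (m + c) (e + f)
  have h₂ := qBinom_mul_qPoch q m c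
  have h₃ := qBinom_mul_qPoch q e f
  have h₄ := qBinom_mul_qPoch q (c + e + f) m
  have h₅ := qBinom_mul_qPoch q (c + e) f
  have h₆ := qBinom_mul_qPoch q c e
  rw [← h₂, ← h₃] at h₁
  rw [← h₅, ← h₆] at h₄
  rw [show m + c + (e + f) = m + c + e + f by ring] at h₁
  rw [show c + e + f + m = m + c + e + f by ring] at h₄
  refine mul_right_cancel₀ (mul_ne_zero (mul_ne_zero (hq m) (hq c))
    (mul_ne_zero (hq e) (hq f))) ?_
  linear_combination h₁ - h₄

theorem qBinom_mul_mul_rearrange (hq : ∀ n, qPoch q n ≠ 0) {M m c : ℕ} (h : m + c ≤ M) (b : ℕ) :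
    q ^ ((m + c) * (m + c + b)) * (qBinom q M (m + c) * (qBinom q (m + c) m *
        qBinom q (M - (m + c)) (c + b) * q ^ ((M - (m + c) - (c + b)) * m))) =
      q ^ (M * m + c * (c + b)) * (qBinom q M (M - m) * qBinom q (M - m) (2 * c + b) *
        qBinom q (2 * c + b) c) := by
  rcases le_or_gt (m + c + (c + b)) M with hM | hM
  · obtain ⟨f, rfl⟩ := Nat.exists_eq_add_of_le hM
    have key := qBinom_multinomial hq m c (c + b) f
    rw [show m + c + (c + b) + f - (m + c) = c + b + f by omega,
      show m + c + (c + b) + f - m = c + (c + b) + f by omega,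
      show 2 * c + b = c + (c + b) by ring, show c + b + f - (c + b) = f by omega, ← key]
    ring
  · rw [qBinom_eq_zero q (n := M - (m + c)) (by omega), qBinom_eq_zero q (n := M - m) (by omega)]
    ring

theorem qBinom_two_mul_eq_sum_sum (hq : ∀ n, qPoch q n ≠ 0) (d b : ℕ) :
    qBinom q (2 * (d + b)) d =
      ∑ m ∈ range (d + b + 1), ∑ c ∈ range (d + b + 1),
        q ^ ((d + b) * m + c * (c + b)) * (qBinom q (d + b) (d + b - m) *
          qBinom q (d + b - m) (2 * c + b) * qBinom q (2 * c + b) c) := by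
  rw [qBinom_two_mul hq]
  generalize d + b = M
  have inner (m : ℕ) (hm : m ∈ range (M + 1)) : ∑ c ∈ range (M + 1), q ^ (M * m + c * (c + b)) *
        (qBinom q M (M - m) * qBinom q (M - m) (2 * c + b) * qBinom q (2 * c + b) c) =
      ∑ c ∈ range (M + 1 - m), q ^ (M * m + c * (c + b)) *
        (qBinom q M (M - m) * qBinom q (M - m) (2 * c + b) * qBinom q (2 * c + b) c) :=
    (sum_subset (by intro x; simp; omega) fun c hc hc' => by
      rw [qBinom_eq_zero q (n := M - m) (by simp at hm hc hc'; omega)]; ring).symm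
  rw [sum_congr rfl inner, ← sum_range_diag_flip (M + 1) fun m c =>
    q ^ (M * m + c * (c + b)) *
      (qBinom q M (M - m) * qBinom q (M - m) (2 * c + b) * qBinom q (2 * c + b) c)]
  refine sum_congr rfl fun j hj => ?_
  have hj : j ≤ M := by simp at hj; omega
  rw [qBinom_add_right_eq_sum q hj, mul_sum, mul_sum]
  refine sum_congr rfl fun m hm => ?_
  obtain ⟨c, rfl⟩ := Nat.exists_eq_add_of_le (show m ≤ j by simp at hm; omega)
  rw [Nat.add_sub_cancel_left, qBinom_mul_mul_rearrange hq hj]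

end QBinom

theorem one_sub_tq_pow_ne_zero (n : ℕ) : (1 : K) - tq ^ (1 + n) ≠ 0 := by
  have h : (1 - Polynomial.X ^ (1 + n) : Polynomial ℚ) ≠ 0 := fun h => by
    simpa using congrArg (Polynomial.eval 0) h
  simpa [tq] using (RatFunc.algebraMap_ne_zero h)

theorem tq_ne_zero : tq ≠ 0 := RatFunc.X_ne_zero

theorem qPoch_tq_ne_zero (n : ℕ) : qPoch tq n ≠ 0 :=
  prod_ne_zero_iff.2 fun j _ => one_sub_tq_pow_ne_zero j

theorem gb_natCast (n k : ℕ) : gb tq n k = qBinom tq n k := by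
  rcases lt_or_ge n k with h | h
  · rw [qBinom_eq_zero _ h, gb, if_neg (by omega)]
  · obtain ⟨l, rfl⟩ := Nat.exists_eq_add_of_le' h
    have key := qBinom_mul_qPoch tq k l
    rw [add_comm k l] at key
    have hsplit : qPoch tq (l + k) =
        qPoch tq l * ∏ j ∈ range k, (1 - tq ^ (((l + k : ℕ) : ℤ) - k + 1 + (j : ℤ))) := by
      rw [qPoch, prod_range_add]
      congr 1
      refine prod_congr rfl fun j _ => ?_
      rw [← zpow_natCast]
      congr 2
      push_cast
      ring
    have hden : ∏ j ∈ range k, (1 - tq ^ (1 + (j : ℤ))) = qPoch tq k :=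
      prod_congr rfl fun j _ => by rw [← zpow_natCast]; push_cast; rfl
    rw [gb, if_pos (by omega), Int.toNat_natCast, prod_div_distrib, hden,
      div_eq_iff (qPoch_tq_ne_zero k)]
    refine mul_left_cancel₀ (qPoch_tq_ne_zero l) ?_
    rw [← hsplit, ← key]
    ring

theorem gb_of_neg (p : K) (n : ℤ) {k : ℤ} (h : k < 0) : gb p n k = 0 :=
  if_neg (by omega)

theorem gb_of_lt (p : K) {n k : ℤ} (h : n < k) : gb p n k = 0 :=
  if_neg (by omega)

theorem gb_symm {n k l : ℤ} (h : k + l = n) : gb tq n k = gb tq n l := by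
  rcases lt_or_ge k 0 with hk | hk
  · rw [gb_of_neg _ _ hk, gb_of_lt _ (by omega)]
  rcases lt_or_ge l 0 with hl | hl
  · rw [gb_of_neg _ _ hl, gb_of_lt _ (by omega)]
  lift k to ℕ using hk
  lift l to ℕ using hl
  subst h
  rw [← Nat.cast_add, gb_natCast, gb_natCast, qBinom_symm_add qPoch_tq_ne_zero]

theorem Cbar_eq_zero {M k : ℕ} (h : M < 2 * k) : Cbar M k = 0 :=
  sum_eq_zero fun i hi => by
    rw [gb_of_lt (n := i) _ (by simp at hi; omega), mul_zero]

theorem Cbar_eq_sum_qBinom (M k : ℕ) :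
    Cbar M k = tq ^ (k ^ 2) *
      ∑ m ∈ range (M + 1), tq ^ (M * m) * (qBinom tq M (M - m) * qBinom tq (M - m) (2 * k)) := by
  rw [Cbar, ← sum_range_reflect, mul_sum]
  refine sum_congr rfl fun m hm => ?_
  obtain ⟨e, rfl⟩ := Nat.exists_eq_add_of_le (show m ≤ M by simp at hm; omega)
  rw [show m + e + 1 - 1 - m = e by omega, Nat.add_sub_cancel_left, gb_natCast,
    show (2 * (k : ℤ)) = ((2 * k : ℕ) : ℤ) by push_cast; rfl, gb_natCast,
    show ((m + e : ℕ) : ℤ) * (((m + e : ℕ) : ℤ) - e) + (k : ℤ) ^ 2 =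
      (((m + e) * m + k ^ 2 : ℕ) : ℤ) by push_cast; ring, zpow_natCast]
  ring

theorem Cbar_sum_natCast (M a : ℕ) :
    ∑ k ∈ range (M + 1), Cbar M k * gb tq (2 * k) ((k : ℤ) - a) =
      tq ^ ((a : ℤ) ^ 2) * gb tq (2 * M) ((M : ℤ) - 2 * a) := by
  rcases lt_or_ge M (2 * a) with h | h
  · rw [gb_of_neg (k := (M : ℤ) - 2 * a) _ _ (by omega), mul_zero]
    refine sum_eq_zero fun k _ => ?_
    rcases lt_or_ge k a with hk | hk
    · rw [gb_of_neg _ _ (by omega), mul_zero]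
    · rw [Cbar_eq_zero (by omega), zero_mul]
  have hshift : ∑ k ∈ range (M + 1), Cbar M k * gb tq (2 * k) ((k : ℤ) - a) =
      ∑ c ∈ range (M + 1), Cbar M (a + c) * qBinom tq (2 * c + 2 * a) c := by
    rw [sum_subset (range_mono (show M + 1 ≤ a + (M + 1) by omega)) fun k _ hk => by
      rw [Cbar_eq_zero (by simp at hk; omega), zero_mul], sum_range_add,
      sum_eq_zero fun k hk => by rw [gb_of_neg _ _ (by simp at hk; omega), mul_zero], zero_add]
    refine sum_congr rfl fun c _ => ?_
    rw [← gb_natCast]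
    congr 2 <;> push_cast <;> ring
  obtain ⟨d, rfl⟩ := Nat.exists_eq_add_of_le' h
  have hpow : tq ^ ((a : ℤ) ^ 2) = tq ^ (a ^ 2) := by rw [← zpow_natCast]; push_cast; rfl
  rw [hshift, show ((d + 2 * a : ℕ) : ℤ) - 2 * a = (d : ℤ) by push_cast; ring,
    show (2 * ((d + 2 * a : ℕ) : ℤ)) = ((2 * (d + 2 * a) : ℕ) : ℤ) by push_cast; rfl,
    gb_natCast, qBinom_two_mul_eq_sum_sum qPoch_tq_ne_zero, sum_comm, mul_sum, hpow]
  refine sum_congr rfl fun c _ => ?_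
  rw [Cbar_eq_sum_qBinom, mul_sum, mul_sum, sum_mul]
  refine sum_congr rfl fun m _ => ?_
  rw [show 2 * (a + c) = 2 * c + 2 * a by ring]
  ring

/-- `Σ_{k=0}^∞ C̄_{M,k}(q) [2k choose k-a] = q^{a²} [2M choose M-2a]`
(terms with `2k > M` vanish, so the sum is finite). -/
theorem Cbar_sum (M : ℕ) (a : ℤ) :
    ∑ k ∈ Finset.range (M + 1), Cbar M k * gb tq (2 * k) ((k : ℤ) - a) =
      tq ^ (a ^ 2) * gb tq (2 * M) ((M : ℤ) - 2 * a) := by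
  obtain ⟨b, rfl | rfl⟩ := a.eq_nat_or_neg
  · exact Cbar_sum_natCast M b
  · rw [neg_sq, gb_symm (l := (M : ℤ) - 2 * b) (by ring), ← Cbar_sum_natCast]
    exact sum_congr rfl fun k _ => by rw [gb_symm (l := (k : ℤ) - b) (by ring)]
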